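/- arXiv:1501.00675 — 19 statements merged into one kernel-verified Lean document; each statement's English description precedes it below -/
import Mathlib

section
/- Let A be a monoid equipped with a binary operation ⊛ satisfying the interchange law (ab)⊛(cd) = (a⊛c)(b⊛d) and 1⊛1 = 1, together with elements γ, η, ε of A satisfying the naturality conditions γ(a⊛(b⊛c)) = ((a⊛b)⊛c)γ, ηa = (1⊛a)η, aε = ε(a⊛1) for all a, b, c ∈ A, and the skew monoidality axioms (γ⊛1)γ(1⊛γ) = γγ, γη = η⊛1, εγ = 1⊛ε, (ε⊛1)γ(1⊛η) = 1, εη = 1. Then the maps T(a) := 1⊛a and Q(a) := a⊛1 are monoid endomorphisms of A, one has a⊛b = Q(a)T(b) for all a, b ∈ A, and (A, T, Q, γ, η, ε) is a γ-presentation of a skew monoidal monoid. -/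
/-- A γ-presentation of a skew monoidal monoid on a monoid `A`: monoid
endomorphisms `T`, `Q` and elements `γ, η, ε` satisfying the eleven axioms. -/
structure GammaSMM (A : Type*) [Monoid A] where
  T : A →* A
  Q : A →* A
  γ : A
  η : A
  ε : A
  g1 : ∀ a b : A, T a * Q b = Q b * T a
  g2 : ∀ a : A, γ * T (T a) = T a * γ
  g3 : ∀ a : A, γ * T (Q a) = Q (T a) * γ
  g4 : ∀ a : A, γ * Q a = Q (Q a) * γ
  g5 : ∀ a : A, η * a = T a * η
  g6 : ∀ a : A, a * ε = ε * Q a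
  g7 : Q γ * γ * T γ = γ * γ
  g8 : γ * η = Q η
  g9 : ε * γ = T ε
  g10 : Q ε * γ * T η = 1
  g11 : ε * η = 1

/-- From a skew monoidal structure `⊛, γ, η, ε` on a monoid `A` one
obtains a γ-presentation with `T(a) := 1 ⊛ a`, `Q(a) := a ⊛ 1`, and
`a ⊛ b = Q(a) T(b)`. -/
theorem smm_from_skew_monoidal_structure {A : Type*} [Monoid A]
    (smp : A → A → A) (γ η ε : A)
    (interchange : ∀ a b c d : A, smp (a * b) (c * d) = smp a c * smp b d)
    (unital : smp 1 1 = 1)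
    (nat_γ : ∀ a b c : A, γ * smp a (smp b c) = smp (smp a b) c * γ)
    (nat_η : ∀ a : A, η * a = smp 1 a * η)
    (nat_ε : ∀ a : A, a * ε = ε * smp a 1)
    (pentagon : smp γ 1 * γ * smp 1 γ = γ * γ)
    (tri1 : γ * η = smp η 1)
    (tri2 : ε * γ = smp 1 ε)
    (tri3 : smp ε 1 * γ * smp 1 η = 1)
    (tri4 : ε * η = 1) :
    -- `T(a) := 1 ⊛ a` is a monoid endomorphism
    ((∀ a b : A, smp 1 (a * b) = smp 1 a * smp 1 b) ∧ smp 1 1 = 1) ∧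
    -- `Q(a) := a ⊛ 1` is a monoid endomorphism
    ((∀ a b : A, smp (a * b) 1 = smp a 1 * smp b 1) ∧ smp 1 1 = 1) ∧
    -- `a ⊛ b = Q(a) T(b)`
    (∀ a b : A, smp a b = smp a 1 * smp 1 b) ∧
    -- `(A, T, Q, γ, η, ε)` is a γ-presentation of a skew monoidal monoid
    (∃ P : GammaSMM A, (∀ a : A, P.T a = smp 1 a) ∧ (∀ a : A, P.Q a = smp a 1) ∧
      P.γ = γ ∧ P.η = η ∧ P.ε = ε) := by
  have hT (a b : A) : smp 1 (a * b) = smp 1 a * smp 1 b := by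
    simpa using interchange 1 1 a b
  have hQ (a b : A) : smp (a * b) 1 = smp a 1 * smp b 1 := by
    simpa using interchange a b 1 1
  have hQT (a b : A) : smp a b = smp a 1 * smp 1 b := by
    simpa using interchange a 1 1 b
  have hTQ (a b : A) : smp b a = smp 1 a * smp b 1 := by
    simpa using interchange 1 b a 1
  refine ⟨⟨hT, unital⟩, ⟨hQ, unital⟩, hQT,
    { T := ⟨⟨fun a => smp 1 a, unital⟩, hT⟩
      Q := ⟨⟨fun a => smp a 1, unital⟩, hQ⟩
      γ := γ
      η := η
      ε := ε
      g1 := fun a b => (hTQ a b).symm.trans (hQT b a)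
      g2 := fun a => by simpa [unital] using nat_γ 1 1 a
      g3 := fun a => nat_γ 1 a 1
      g4 := fun a => by simpa [unital] using nat_γ a 1 1
      g5 := nat_η
      g6 := nat_ε
      g7 := pentagon
      g8 := tri1
      g9 := tri2
      g10 := tri3
      g11 := tri4 },
    fun _ => rfl, fun _ => rfl, rfl, rfl, rfl⟩
end

section
/- Let (A, T, Q, γ, η, ε) be a γ-presentation of a skew monoidal monoid. Define a⊛b := Q(a)T(b). Then ⊛ satisfies the interchange law (ab)⊛(cd) = (a⊛c)(b⊛d) and 1⊛1 = 1, the naturality conditions γ(a⊛(b⊛c)) = ((a⊛b)⊛c)γ, ηa = (1⊛a)η, aε = ε(a⊛1) hold for all a, b, c ∈ A, and the skew monoidality axioms (γ⊛1)γ(1⊛γ) = γγ, γη = η⊛1, εγ = 1⊛ε, (ε⊛1)γ(1⊛η) = 1, εη = 1 hold. -/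
/-- From a γ-presentation `(A, T, Q, γ, η, ε)`, defining
`a ⊛ b := Q(a) T(b)` yields a skew monoidal structure on the monoid `A`. -/
theorem skew_monoidal_structure_from_gamma_presentation {A : Type*} [Monoid A]
    (P : GammaSMM A) (smp : A → A → A)
    (hsmp : ∀ a b : A, smp a b = P.Q a * P.T b) :
    -- interchange law and unitality
    (∀ a b c d : A, smp (a * b) (c * d) = smp a c * smp b d) ∧
    (smp 1 1 = 1) ∧
    -- naturality conditions
    (∀ a b c : A, P.γ * smp a (smp b c) = smp (smp a b) c * P.γ) ∧
    (∀ a : A, P.η * a = smp 1 a * P.η) ∧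
    (∀ a : A, a * P.ε = P.ε * smp a 1) ∧
    -- skew monoidality axioms
    (smp P.γ 1 * P.γ * smp 1 P.γ = P.γ * P.γ) ∧
    (P.γ * P.η = smp P.η 1) ∧
    (P.ε * P.γ = smp 1 P.ε) ∧
    (smp P.ε 1 * P.γ * smp 1 P.η = 1) ∧
    (P.ε * P.η = 1) := by
  simp only [hsmp, map_one, one_mul, mul_one]
  refine ⟨fun a b c d => ?_, trivial, fun a b c => ?_, P.g5, P.g6, P.g7, P.g8, P.g9, P.g10, P.g11⟩
  · simp only [map_mul, mul_assoc]
    rw [← mul_assoc (P.Q b), ← P.g1 c b, mul_assoc]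
  · calc P.γ * (P.Q a * P.T (P.Q b * P.T c))
        = P.γ * P.Q a * P.T (P.Q b) * P.T (P.T c) := by simp only [map_mul, mul_assoc]
      _ = P.Q (P.Q a) * (P.γ * P.T (P.Q b)) * P.T (P.T c) := by rw [P.g4, mul_assoc (P.Q (P.Q a))]
      _ = P.Q (P.Q a) * P.Q (P.T b) * (P.γ * P.T (P.T c)) := by simp only [P.g3, mul_assoc]
      _ = P.Q (P.Q a * P.T b) * P.T c * P.γ := by simp only [P.g2, map_mul, mul_assoc]
end

section
/- Let (A, T, Q, γ, η, ε) be a γ-presentation of a skew monoidal monoid. Define μ := Q(ε)γ and δ := γT(η). Then (A, T, Q, μ, η, δ, ε) is a skew monoidal monoid, i.e., all eighteen SMM axioms hold. -/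
/-- A skew monoidal monoid (SMM) on a monoid `A`: monoid endomorphisms `T`, `Q`
and elements `μ, η, δ, ε` satisfying the eighteen SMM axioms. -/
structure SMM (A : Type*) [Monoid A] where
  T : A →* A
  Q : A →* A
  μ : A
  η : A
  δ : A
  ε : A
  sm1 : ∀ a : A, μ * T (T a) = T a * μ
  sm2 : ∀ a : A, η * a = T a * η
  sm3 : ∀ a : A, δ * Q a = Q (Q a) * δ
  sm4 : ∀ a : A, a * ε = ε * Q a
  sm5 : ∀ a : A, μ * δ * T (Q a) = Q (T a) * (μ * δ)
  sm6 : ∀ a b : A, T a * Q b = Q b * T a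
  sm7 : ∀ a : A, μ * Q a = Q a * μ
  sm8 : ∀ a : A, δ * T a = T a * δ
  sm9 : μ * T μ = μ * μ
  sm10 : μ * η = 1
  sm11 : μ * T η = 1
  sm12 : Q δ * δ = δ * δ
  sm13 : ε * δ = 1
  sm14 : Q ε * δ = 1
  sm15 : Q μ * μ * δ * T δ = δ * μ
  sm16 : ε * μ = ε * T ε
  sm17 : δ * η = Q η * η
  sm18 : ε * η = 1

/-- The antipode-like map `S(a) := μ T(Q(a) η)`. -/
def SMM.S {A : Type*} [Monoid A] (M : SMM A) (a : A) : A :=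
  M.μ * M.T (M.Q a * M.η)

/-- The map `π(a) := ε a η`. -/
def SMM.π {A : Type*} [Monoid A] (M : SMM A) (a : A) : A :=
  M.ε * a * M.η

/-- A `T`-algebra: an element `x` with `x μ = x T(x)` and `x η = 1`. -/
def SMM.IsTAlg {A : Type*} [Monoid A] (M : SMM A) (x : A) : Prop :=
  x * M.μ = x * M.T x ∧ x * M.η = 1

/-- Horizontal tensor product of `T`-algebras: `x ⊛ y := y Q(x) δ`. -/
def SMM.hot {A : Type*} [Monoid A] (M : SMM A) (x y : A) : A :=
  y * M.Q x * M.δ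

/-- A `Q`-coalgebra: an element `u` with `Q(u) u = δ u` and `ε u = 1`. -/
def SMM.IsQCoalg {A : Type*} [Monoid A] (M : SMM A) (u : A) : Prop :=
  M.Q u * u = M.δ * u ∧ M.ε * u = 1

/-- Vertical tensor product of `Q`-coalgebras: `u ⊛' v := μ T(v) u`. -/
def SMM.vot {A : Type*} [Monoid A] (M : SMM A) (u v : A) : A :=
  M.μ * M.T v * u

namespace GammaSMM

variable {A : Type*} [Monoid A] (P : GammaSMM A)

/-- The fusion map `γ` is recovered as the product `μ δ`. -/
theorem mul_comul_eq_gamma :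
    P.Q P.ε * P.γ * (P.γ * P.T P.η) = P.γ := by
  calc P.Q P.ε * P.γ * (P.γ * P.T P.η)
      = P.Q P.ε * (P.γ * P.γ) * P.T P.η := by simp only [mul_assoc]
    _ = P.Q (P.ε * P.γ) * P.γ * P.T (P.γ * P.η) := by
        simp only [← P.g7, map_mul, mul_assoc]
    _ = P.Q (P.T P.ε) * (P.γ * P.T (P.Q P.η)) := by rw [P.g9, P.g8, mul_assoc]
    _ = P.Q (P.T (P.ε * P.η)) * P.γ := by rw [P.g3]; simp only [map_mul, mul_assoc]
    _ = P.γ := by rw [P.g11, map_one, map_one, one_mul]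

theorem counit_mul_mul : P.ε * (P.Q P.ε * P.γ) = P.ε * P.T P.ε := by
  rw [← mul_assoc, ← P.g6, mul_assoc, P.g9]

theorem comul_mul_unit : P.γ * P.T P.η * P.η = P.Q P.η * P.η := by
  rw [mul_assoc, ← P.g5, ← mul_assoc, P.g8]

theorem mul_associative :
    P.Q P.ε * P.γ * P.T (P.Q P.ε * P.γ) = P.Q P.ε * P.γ * (P.Q P.ε * P.γ) := by
  calc P.Q P.ε * P.γ * P.T (P.Q P.ε * P.γ)
      = P.Q P.ε * (P.γ * P.T (P.Q P.ε)) * P.T P.γ := by simp only [map_mul, mul_assoc]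
    _ = P.Q (P.ε * P.T P.ε) * P.γ * P.T P.γ := by rw [P.g3]; simp only [map_mul, mul_assoc]
    _ = P.Q P.ε * P.Q (P.Q P.ε) * (P.Q P.γ * P.γ * P.T P.γ) := by
        rw [← P.counit_mul_mul]; simp only [map_mul, mul_assoc]
    _ = P.Q P.ε * (P.Q (P.Q P.ε) * P.γ) * P.γ := by rw [P.g7]; simp only [mul_assoc]
    _ = P.Q P.ε * P.γ * (P.Q P.ε * P.γ) := by rw [← P.g4]; simp only [mul_assoc]

theorem comul_coassociative :
    P.Q (P.γ * P.T P.η) * (P.γ * P.T P.η) = P.γ * P.T P.η * (P.γ * P.T P.η) := by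
  calc P.Q (P.γ * P.T P.η) * (P.γ * P.T P.η)
      = P.Q P.γ * (P.Q (P.T P.η) * P.γ) * P.T P.η := by simp only [map_mul, mul_assoc]
    _ = P.Q P.γ * P.γ * P.T (P.Q P.η * P.η) := by rw [← P.g3]; simp only [map_mul, mul_assoc]
    _ = P.Q P.γ * P.γ * P.T P.γ * (P.T (P.T P.η) * P.T P.η) := by
        rw [← P.comul_mul_unit]; simp only [map_mul, mul_assoc]
    _ = P.γ * (P.γ * P.T (P.T P.η)) * P.T P.η := by rw [P.g7]; simp only [mul_assoc]
    _ = P.γ * P.T P.η * (P.γ * P.T P.η) := by rw [P.g2]; simp only [mul_assoc]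

theorem mul_comul_compat :
    P.Q (P.Q P.ε * P.γ) * P.γ * P.T (P.γ * P.T P.η) =
      P.γ * P.T P.η * (P.Q P.ε * P.γ) := by
  calc P.Q (P.Q P.ε * P.γ) * P.γ * P.T (P.γ * P.T P.η)
      = P.Q (P.Q P.ε) * (P.Q P.γ * P.γ * P.T P.γ) * P.T (P.T P.η) := by
        simp only [map_mul, mul_assoc]
    _ = (P.Q (P.Q P.ε) * P.γ) * (P.γ * P.T (P.T P.η)) := by rw [P.g7]; simp only [mul_assoc]
    _ = P.γ * (P.Q P.ε * P.T P.η) * P.γ := by rw [← P.g4, P.g2]; simp only [mul_assoc]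
    _ = P.γ * P.T P.η * (P.Q P.ε * P.γ) := by rw [← P.g1]; simp only [mul_assoc]

end GammaSMM

/-- From a γ-presentation `(A, T, Q, γ, η, ε)`, setting
`μ := Q(ε) γ` and `δ := γ T(η)` yields a skew monoidal monoid
`(A, T, Q, μ, η, δ, ε)`: all eighteen SMM axioms hold. -/
theorem smm_from_gamma_presentation {A : Type*} [Monoid A]
    (P : GammaSMM A) (μ δ : A)
    (hμ : μ = P.Q P.ε * P.γ) (hδ : δ = P.γ * P.T P.η) :
    (∀ a : A, μ * P.T (P.T a) = P.T a * μ) ∧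
    (∀ a : A, P.η * a = P.T a * P.η) ∧
    (∀ a : A, δ * P.Q a = P.Q (P.Q a) * δ) ∧
    (∀ a : A, a * P.ε = P.ε * P.Q a) ∧
    (∀ a : A, μ * δ * P.T (P.Q a) = P.Q (P.T a) * (μ * δ)) ∧
    (∀ a b : A, P.T a * P.Q b = P.Q b * P.T a) ∧
    (∀ a : A, μ * P.Q a = P.Q a * μ) ∧
    (∀ a : A, δ * P.T a = P.T a * δ) ∧
    (μ * P.T μ = μ * μ) ∧
    (μ * P.η = 1) ∧
    (μ * P.T P.η = 1) ∧
    (P.Q δ * δ = δ * δ) ∧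
    (P.ε * δ = 1) ∧
    (P.Q P.ε * δ = 1) ∧
    (P.Q μ * μ * δ * P.T δ = δ * μ) ∧
    (P.ε * μ = P.ε * P.T P.ε) ∧
    (δ * P.η = P.Q P.η * P.η) ∧
    (P.ε * P.η = 1) := by
  subst hμ hδ
  refine ⟨fun a => ?_, P.g5, fun a => ?_, P.g6, fun a => ?_, P.g1, fun a => ?_, fun a => ?_,
    P.mul_associative, ?_, P.g10, P.comul_coassociative, ?_, ?_, ?_, P.counit_mul_mul,
    P.comul_mul_unit, P.g11⟩
  · rw [mul_assoc, P.g2, ← mul_assoc, ← P.g1, mul_assoc]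
  · rw [mul_assoc, P.g1, ← mul_assoc, P.g4, mul_assoc]
  · rw [P.mul_comul_eq_gamma, P.g3]
  · rw [mul_assoc, P.g4, ← mul_assoc, ← map_mul, ← P.g6, map_mul, mul_assoc]
  · rw [mul_assoc, ← map_mul, P.g5, map_mul, ← mul_assoc, P.g2, mul_assoc]
  · rw [mul_assoc, P.g8, ← map_mul, P.g11, map_one]
  · rw [← mul_assoc, P.g9, ← map_mul, P.g11, map_one]
  · rw [← mul_assoc, P.g10]
  · rw [mul_assoc (P.Q (P.Q P.ε * P.γ)), P.mul_comul_eq_gamma, P.mul_comul_compat]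
end

section
/- Let (A, T, Q, μ, η, δ, ε) be a skew monoidal monoid. Define γ := μδ. Then (A, T, Q, γ, η, ε) is a γ-presentation of a skew monoidal monoid, i.e., all eleven γ-presentation axioms hold; moreover Q(ε)γ = μ and γT(η) = δ. -/
/-- From a skew monoidal monoid `(A, T, Q, μ, η, δ, ε)`, setting
`γ := μ δ` yields a γ-presentation `(A, T, Q, γ, η, ε)` (all eleven axioms
hold); moreover `Q(ε) γ = μ` and `γ T(η) = δ`. -/
theorem gamma_presentation_from_smm {A : Type*} [Monoid A]
    (M : SMM A) (γ : A) (hγ : γ = M.μ * M.δ) :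
    (∀ a b : A, M.T a * M.Q b = M.Q b * M.T a) ∧
    (∀ a : A, γ * M.T (M.T a) = M.T a * γ) ∧
    (∀ a : A, γ * M.T (M.Q a) = M.Q (M.T a) * γ) ∧
    (∀ a : A, γ * M.Q a = M.Q (M.Q a) * γ) ∧
    (∀ a : A, M.η * a = M.T a * M.η) ∧
    (∀ a : A, a * M.ε = M.ε * M.Q a) ∧
    (M.Q γ * γ * M.T γ = γ * γ) ∧
    (γ * M.η = M.Q M.η) ∧
    (M.ε * γ = M.T M.ε) ∧
    (M.Q M.ε * γ * M.T M.η = 1) ∧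
    (M.ε * M.η = 1) ∧
    (M.Q M.ε * γ = M.μ) ∧
    (γ * M.T M.η = M.δ) := by
  subst hγ
  have hQε : M.Q M.ε * (M.μ * M.δ) = M.μ := by
    rw [← mul_assoc, ← M.sm7, mul_assoc, M.sm14, mul_one]
  refine ⟨M.sm6, fun a => ?_, M.sm5, fun a => ?_, M.sm2, M.sm4, ?_, ?_, ?_, ?_, M.sm18, hQε, ?_⟩
  · rw [mul_assoc, M.sm8, ← mul_assoc, M.sm1, mul_assoc]
  · rw [mul_assoc, M.sm3, ← mul_assoc, M.sm7, mul_assoc]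
  · calc
      M.Q (M.μ * M.δ) * (M.μ * M.δ) * M.T (M.μ * M.δ)
          = M.Q M.μ * (M.Q M.δ * M.μ) * (M.δ * M.T M.μ) * M.T M.δ := by
            simp only [map_mul, mul_assoc]
      _ = M.Q M.μ * M.μ * M.Q M.δ * (M.T M.μ * M.δ) * M.T M.δ := by
            rw [← M.sm7, M.sm8]; simp only [mul_assoc]
      _ = M.Q M.μ * M.μ * (M.T M.μ * M.Q M.δ) * M.δ * M.T M.δ := by
            rw [M.sm6]; simp only [mul_assoc]
      _ = M.Q M.μ * (M.μ * M.T M.μ) * (M.Q M.δ * M.δ) * M.T M.δ := by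
            simp only [mul_assoc]
      _ = (M.Q M.μ * M.μ) * M.μ * M.δ * (M.δ * M.T M.δ) := by
            rw [M.sm9, M.sm12]; simp only [mul_assoc]
      _ = M.μ * (M.Q M.μ * M.μ * M.δ * M.T M.δ) * M.δ := by
            rw [M.sm8]; simp only [← mul_assoc, M.sm7]
      _ = M.μ * M.δ * (M.μ * M.δ) := by
            rw [M.sm15]; simp only [mul_assoc]
  · rw [mul_assoc, M.sm17, ← mul_assoc, M.sm7, mul_assoc, M.sm10, mul_one]
  · rw [← mul_assoc, M.sm16, mul_assoc, ← M.sm8, ← mul_assoc, M.sm13, one_mul]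
  · rw [hQε, M.sm11]
  · rw [mul_assoc, M.sm8, ← mul_assoc, M.sm11, one_mul]
end

section
/- Let (A, T, Q, μ, η, δ, ε) be a skew monoidal monoid. Then π(T(a)) = a, π(Q(a)) = a and π(S(a)) = a for all a ∈ A; consequently T, Q and S are injective. Moreover the two formulas for S agree: μT(Q(a)η) = Q(εT(a))δ for all a ∈ A. -/
theorem SMM.π_T {A : Type*} [Monoid A] (M : SMM A) (a : A) : M.π (M.T a) = a := by
  rw [SMM.π, mul_assoc, ← M.sm2, ← mul_assoc, M.sm18, one_mul]

theorem SMM.π_Q {A : Type*} [Monoid A] (M : SMM A) (a : A) : M.π (M.Q a) = a := by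
  rw [SMM.π, ← M.sm4, mul_assoc, M.sm18, mul_one]

theorem SMM.S_mul_η {A : Type*} [Monoid A] (M : SMM A) (a : A) :
    M.S a * M.η = M.Q a * M.η := by
  rw [SMM.S, mul_assoc, ← M.sm2, ← mul_assoc, M.sm10, one_mul]

theorem SMM.π_S {A : Type*} [Monoid A] (M : SMM A) (a : A) : M.π (M.S a) = a := by
  rw [SMM.π, mul_assoc, M.S_mul_η, ← mul_assoc]
  exact M.π_Q a

theorem SMM.Q_T_mul_δ {A : Type*} [Monoid A] (M : SMM A) (a : A) :
    M.Q (M.T a) * M.δ = M.μ * M.δ * M.T (M.Q a * M.η) := by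
  rw [map_mul, ← mul_assoc, M.sm5, mul_assoc, mul_assoc, M.sm8, ← mul_assoc M.μ, M.sm11, one_mul]

theorem SMM.S_eq {A : Type*} [Monoid A] (M : SMM A) (a : A) :
    M.S a = M.Q (M.ε * M.T a) * M.δ := by
  rw [map_mul, mul_assoc, M.Q_T_mul_δ, ← mul_assoc, ← mul_assoc, ← M.sm7, mul_assoc M.μ, M.sm14,
    mul_one, SMM.S]

/-- `π` is a common left inverse of `T`, `Q` and `S`, hence these
are injective; moreover the two formulas for `S` agree. -/
theorem pi_left_inverse_and_S_formulas {A : Type*} [Monoid A] (M : SMM A) :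
    (∀ a : A, M.π (M.T a) = a) ∧
    (∀ a : A, M.π (M.Q a) = a) ∧
    (∀ a : A, M.π (M.S a) = a) ∧
    Function.Injective M.T ∧
    Function.Injective M.Q ∧
    Function.Injective M.S ∧
    (∀ a : A, M.μ * M.T (M.Q a * M.η) = M.Q (M.ε * M.T a) * M.δ) := by
  exact ⟨M.π_T, M.π_Q, M.π_S, Function.LeftInverse.injective M.π_T,
    Function.LeftInverse.injective M.π_Q, Function.LeftInverse.injective M.π_S, M.S_eq⟩
end

section
/- Let (A, T, Q, μ, η, δ, ε) be a skew monoidal monoid. Then the images of Q, S and T pairwise commute elementwise: for all a, b ∈ A one has S(a)Q(b) = Q(b)S(a), S(a)T(b) = T(b)S(a) and T(a)Q(b) = Q(b)T(a). -/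
/-- The images of `Q`, `S` and `T` pairwise commute elementwise. -/
theorem images_pairwise_commute {A : Type*} [Monoid A] (M : SMM A) :
    (∀ a b : A, M.S a * M.Q b = M.Q b * M.S a) ∧
    (∀ a b : A, M.S a * M.T b = M.T b * M.S a) ∧
    (∀ a b : A, M.T a * M.Q b = M.Q b * M.T a) := by
  refine ⟨fun a b ↦ ?_, fun a b ↦ ?_, M.sm6⟩
  · rw [SMM.S, mul_assoc, M.sm6, ← mul_assoc, M.sm7, mul_assoc]
  · have h : M.Q a * M.η * b = M.T b * (M.Q a * M.η) := by
      rw [mul_assoc, M.sm2, ← mul_assoc, ← M.sm6, mul_assoc]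
    rw [SMM.S, mul_assoc, ← map_mul, h, map_mul, ← mul_assoc, M.sm1, mul_assoc]
end

section
/- Let (A, T, Q, μ, η, δ, ε) be a skew monoidal monoid. Then S is an anti-endomorphism of A, i.e., S(ab) = S(b)S(a) for all a, b ∈ A and S(1) = 1. Moreover, for all a ∈ A the following relations hold: μS(a) = μT(Q(a)); S(a)μ = μT(S(a)); S(a)δ = Q(T(a))δ; δS(a) = Q(S(a))δ; S(a)η = Q(a)η; εS(a) = εT(a). -/
namespace SMM

variable {A : Type*} [Monoid A] (M : SMM A)

theorem μ_mul_S (a : A) : M.μ * M.S a = M.μ * M.T (M.Q a) :=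
  calc M.μ * M.S a = M.μ * M.μ * M.T (M.Q a * M.η) := by rw [S, mul_assoc]
    _ = M.μ * M.T (M.μ * M.Q a * M.η) := by
      rw [← M.sm9]; simp only [map_mul, mul_assoc]
    _ = M.μ * M.T (M.Q a) := by rw [M.sm7, mul_assoc, M.sm10, mul_one]

theorem S_mul_η_s6 (a : A) : M.S a * M.η = M.Q a * M.η := by
  rw [S, mul_assoc, ← M.sm2, ← mul_assoc, M.sm10, one_mul]

theorem S_mul_μ (a : A) : M.S a * M.μ = M.μ * M.T (M.S a) := by
  rw [S, mul_assoc, ← M.sm1, ← mul_assoc, ← M.sm9, mul_assoc, ← map_mul]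

theorem ε_mul_S (a : A) : M.ε * M.S a = M.ε * M.T a := by
  rw [S, ← mul_assoc, M.sm16, mul_assoc, ← map_mul, ← mul_assoc, ← M.sm4, mul_assoc,
    M.sm18, mul_one]

theorem S_mul_Q (a b : A) : M.S a * M.Q b = M.Q b * M.S a := by
  rw [S, mul_assoc, M.sm6, ← mul_assoc, M.sm7, mul_assoc]

theorem S_mul (a b : A) : M.S (a * b) = M.S b * M.S a :=
  calc M.S (a * b) = M.μ * M.T (M.Q a * (M.Q b * M.η)) := by rw [S, map_mul M.Q, mul_assoc]
    _ = M.μ * M.T (M.S b * (M.Q a * M.η)) := by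
      rw [← M.S_mul_η_s6, ← mul_assoc, ← M.S_mul_Q, mul_assoc]
    _ = M.S b * M.S a := by
      rw [map_mul, ← mul_assoc, ← M.S_mul_μ, mul_assoc, ← S]

theorem S_one : M.S 1 = 1 := by
  rw [S, map_one, one_mul, M.sm11]

theorem μ_mul_δ_mul_T_η : M.μ * M.δ * M.T M.η = M.δ := by
  rw [mul_assoc, M.sm8, ← mul_assoc, M.sm11, one_mul]

theorem S_mul_δ (a : A) : M.S a * M.δ = M.Q (M.T a) * M.δ := by
  rw [S, mul_assoc, ← M.sm8, ← mul_assoc, map_mul, ← mul_assoc, M.sm5, mul_assoc,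
    M.μ_mul_δ_mul_T_η]

theorem δ_mul_S (a : A) : M.δ * M.S a = M.Q (M.S a) * M.δ :=
  calc M.δ * M.S a = M.Q M.μ * (M.μ * M.δ) * M.T (M.δ * M.Q a * M.η) := by
        rw [S, ← mul_assoc, ← M.sm15]; simp only [map_mul, mul_assoc]
    _ = M.Q M.μ * (M.μ * M.δ) * M.T (M.Q (M.Q a * M.η) * M.η) := by
        rw [M.sm3, mul_assoc (M.Q (M.Q a)), M.sm17, map_mul M.Q, mul_assoc (M.Q (M.Q a))]
    _ = M.Q M.μ * (M.μ * M.δ * M.T (M.Q (M.Q a * M.η))) * M.T M.η := by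
        rw [map_mul M.T]; simp only [mul_assoc]
    _ = M.Q M.μ * M.Q (M.T (M.Q a * M.η)) * (M.μ * M.δ * M.T M.η) := by
        rw [M.sm5]; simp only [mul_assoc]
    _ = M.Q (M.S a) * M.δ := by rw [M.μ_mul_δ_mul_T_η, ← map_mul, S]

end SMM

/-- `S` is an anti-endomorphism of `A`, and the six useful
relations involving `S`, `μ`, `δ`, `η`, `ε` hold. -/
theorem S_anti_endomorphism_and_relations {A : Type*} [Monoid A] (M : SMM A) :
    (∀ a b : A, M.S (a * b) = M.S b * M.S a) ∧
    (M.S 1 = 1) ∧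
    (∀ a : A, M.μ * M.S a = M.μ * M.T (M.Q a)) ∧
    (∀ a : A, M.S a * M.μ = M.μ * M.T (M.S a)) ∧
    (∀ a : A, M.S a * M.δ = M.Q (M.T a) * M.δ) ∧
    (∀ a : A, M.δ * M.S a = M.Q (M.S a) * M.δ) ∧
    (∀ a : A, M.S a * M.η = M.Q a * M.η) ∧
    (∀ a : A, M.ε * M.S a = M.ε * M.T a) :=
  ⟨M.S_mul, M.S_one, M.μ_mul_S, M.S_mul_μ, M.S_mul_δ, M.δ_mul_S, M.S_mul_η_s6, M.ε_mul_S⟩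
end

section
/- Let (A, T, Q, μ, η, δ, ε) be a skew monoidal monoid. Then S(A) = F ∩ G; that is, an element x ∈ A satisfies (∃ a ∈ A, x = Q(a)δ) and (∃ b ∈ A, x = μT(b)) if and only if there exists y ∈ A with x = S(y). -/
/-- The comultiplication is recovered from `μ`, `δ` and `η`. -/
theorem SMM.mu_mul_delta_mul_T_eta {A : Type*} [Monoid A] (M : SMM A) :
    M.μ * M.δ * M.T M.η = M.δ := by
  calc M.μ * M.δ * M.T M.η
      = M.Q (M.μ * M.T M.η) * (M.μ * M.δ) * M.T M.η := by rw [M.sm11, map_one, one_mul]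
    _ = M.Q M.μ * (M.Q (M.T M.η) * (M.μ * M.δ)) * M.T M.η := by
        rw [map_mul]; simp only [mul_assoc]
    _ = M.Q M.μ * M.μ * M.δ * M.T (M.Q M.η * M.η) := by
        rw [← M.sm5, map_mul]; simp only [mul_assoc]
    _ = M.Q M.μ * M.μ * M.δ * M.T M.δ * M.T M.η := by
        rw [← M.sm17, map_mul]; simp only [mul_assoc]
    _ = M.δ := by rw [M.sm15, mul_assoc, M.sm11, mul_one]

theorem SMM.S_eq_Q_mul_delta {A : Type*} [Monoid A] (M : SMM A) (y : A) :
    M.S y = M.Q (M.ε * M.T y) * M.δ := by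
  symm
  calc M.Q (M.ε * M.T y) * M.δ
      = M.Q M.ε * (M.Q (M.T y) * (M.μ * M.δ)) * M.T M.η := by
        conv_lhs => rw [← M.mu_mul_delta_mul_T_eta]
        rw [map_mul]; simp only [mul_assoc]
    _ = M.Q M.ε * M.μ * M.δ * M.T (M.Q y * M.η) := by
        rw [← M.sm5, map_mul]; simp only [mul_assoc]
    _ = M.μ * (M.Q M.ε * M.δ) * M.T (M.Q y * M.η) := by
        rw [← M.sm7]; simp only [mul_assoc]
    _ = M.S y := by rw [M.sm14, mul_one, SMM.S]

theorem SMM.mu_mul_T_mul_eta {A : Type*} [Monoid A] (M : SMM A) (b : A) :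
    M.μ * M.T b * M.η = b := by
  rw [mul_assoc, ← M.sm2, ← mul_assoc, M.sm10, one_mul]

/-- `S(A) = F ∩ G` where `F = Q(A)δ` and `G = μT(A)`. -/
theorem S_image_eq_F_inter_G {A : Type*} [Monoid A] (M : SMM A) (x : A) :
    ((∃ a : A, x = M.Q a * M.δ) ∧ (∃ b : A, x = M.μ * M.T b)) ↔
      (∃ y : A, x = M.S y) := by
  constructor
  · rintro ⟨⟨a, ha⟩, b, hb⟩
    have hba : b = M.Q (a * M.η) * M.η := by
      rw [← M.mu_mul_T_mul_eta b, ← hb, ha, mul_assoc, M.sm17, map_mul, mul_assoc]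
    exact ⟨a * M.η, by rw [hb, hba, SMM.S]⟩
  · rintro ⟨y, rfl⟩
    exact ⟨⟨_, M.S_eq_Q_mul_delta y⟩, _, rfl⟩
end

section
/- Let (A, T, Q, μ, η, δ, ε) be a skew monoidal monoid. Then F := {Q(a)δ : a ∈ A} and G := {μT(a) : a ∈ A} are submonoids of A (each contains 1 and is closed under multiplication), and one has the inclusions Q(A) ⊆ F, S(A) ⊆ F, S(A) ⊆ G and T(A) ⊆ G. -/
namespace SMM

variable {A : Type*} [Monoid A] (M : SMM A)

theorem Q_mul_δ_mul_Q_mul_δ (a b : A) :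
    M.Q a * M.δ * (M.Q b * M.δ) = M.Q (a * M.Q b * M.δ) * M.δ := by
  calc
    _ = M.Q a * (M.δ * M.Q b) * M.δ := by simp only [mul_assoc]
    _ = M.Q a * M.Q (M.Q b) * (M.δ * M.δ) := by rw [M.sm3]; simp only [mul_assoc]
    _ = _ := by rw [← M.sm12]; simp only [map_mul, mul_assoc]

theorem μ_mul_T_mul_μ_mul_T (a b : A) :
    M.μ * M.T a * (M.μ * M.T b) = M.μ * M.T (M.μ * M.T a * b) := by
  calc
    _ = M.μ * (M.T a * M.μ) * M.T b := by simp only [mul_assoc]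
    _ = M.μ * M.μ * M.T (M.T a) * M.T b := by rw [← M.sm1]; simp only [mul_assoc]
    _ = _ := by rw [← M.sm9]; simp only [map_mul, mul_assoc]

theorem Q_mul_ε_mul_δ (a : A) : M.Q (a * M.ε) * M.δ = M.Q a := by
  rw [map_mul, mul_assoc, M.sm14, mul_one]

theorem μ_mul_T_T_mul_η (a : A) : M.μ * M.T (M.T a * M.η) = M.T a := by
  rw [map_mul, ← mul_assoc, M.sm1, mul_assoc, M.sm11, mul_one]

theorem δ_mul_Q_mul_η (a : A) : M.δ * (M.Q a * M.η) = M.Q (M.Q a * M.η) * M.η := by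
  rw [← mul_assoc, M.sm3, mul_assoc, M.sm17, ← mul_assoc, map_mul]

theorem S_eq_Q_mul_δ (a : A) : M.S a = M.Q (M.ε * M.S a) * M.δ := by
  have h : M.T M.δ * M.T (M.Q a * M.η) = M.T (M.Q (M.Q a * M.η)) * M.T M.η := by
    rw [← map_mul, δ_mul_Q_mul_η, map_mul]
  unfold S
  calc
    _ = M.Q M.ε * (M.δ * M.μ) * M.T (M.Q a * M.η) := by
      rw [← mul_assoc (M.Q M.ε), M.sm14, one_mul]
    _ = M.Q M.ε * M.Q M.μ * (M.μ * M.δ) * (M.T M.δ * M.T (M.Q a * M.η)) := by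
      rw [← M.sm15]; simp only [mul_assoc]
    _ = M.Q M.ε * M.Q M.μ * (M.μ * M.δ * M.T (M.Q (M.Q a * M.η))) * M.T M.η := by
      rw [h]; simp only [mul_assoc]
    _ = M.Q (M.ε * (M.μ * M.T (M.Q a * M.η))) * (M.μ * M.δ * M.T M.η) := by
      rw [M.sm5]; simp only [map_mul, mul_assoc]
    _ = _ := by rw [μ_mul_δ_mul_T_η]

end SMM

/-- `F := Q(A)δ` and `G := μT(A)` are submonoids of `A`, with the
inclusions `Q(A) ⊆ F ⊇ S(A) ⊆ G ⊇ T(A)`. -/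
theorem F_and_G_submonoids_and_inclusions {A : Type*} [Monoid A] (M : SMM A)
    (F G : Set A)
    (hF : F = {f : A | ∃ a : A, f = M.Q a * M.δ})
    (hG : G = {g : A | ∃ a : A, g = M.μ * M.T a}) :
    (1 ∈ F) ∧ (∀ x ∈ F, ∀ y ∈ F, x * y ∈ F) ∧
    (1 ∈ G) ∧ (∀ x ∈ G, ∀ y ∈ G, x * y ∈ G) ∧
    (∀ a : A, M.Q a ∈ F) ∧
    (∀ a : A, M.S a ∈ F) ∧
    (∀ a : A, M.S a ∈ G) ∧
    (∀ a : A, M.T a ∈ G) := by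
  subst hF hG
  refine ⟨⟨M.ε, M.sm14.symm⟩, ?_, ⟨M.η, M.sm11.symm⟩, ?_,
    fun a => ⟨_, (M.Q_mul_ε_mul_δ a).symm⟩, fun a => ⟨_, M.S_eq_Q_mul_δ a⟩,
    fun a => ⟨_, rfl⟩, fun a => ⟨_, (M.μ_mul_T_T_mul_η a).symm⟩⟩
  · rintro _ ⟨a, rfl⟩ _ ⟨b, rfl⟩
    exact ⟨_, M.Q_mul_δ_mul_Q_mul_δ a b⟩
  · rintro _ ⟨a, rfl⟩ _ ⟨b, rfl⟩
    exact ⟨_, M.μ_mul_T_mul_μ_mul_T a b⟩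
end

section
/- Let (A, T, Q, μ, η, δ, ε) be a skew monoidal monoid. If x and y are T-algebras, then x ⊛ y := yQ(x)δ is again a T-algebra. The horizontal tensor product is strictly associative on T-algebras, (x ⊛ y) ⊛ z = x ⊛ (y ⊛ z), the element ε is a T-algebra, and ε ⊛ x = x = x ⊛ ε for every T-algebra x. -/
namespace SMM

variable {A : Type*} [Monoid A] (M : SMM A)

theorem IsTAlg.hot {M : SMM A} {x y : A} (hx : M.IsTAlg x) (hy : M.IsTAlg y) :
    M.IsTAlg (M.hot x y) := by
  constructor
  · calc y * M.Q x * M.δ * M.μ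
        = y * (M.Q x * M.Q M.μ) * (M.μ * M.δ * M.T M.δ) := by
          rw [mul_assoc _ M.δ, ← M.sm15]; simp only [mul_assoc]
      _ = y * M.Q x * (M.Q (M.T x) * (M.μ * M.δ)) * M.T M.δ := by
          rw [← map_mul, hx.1, map_mul]; simp only [mul_assoc]
      _ = y * (M.Q x * M.μ) * M.δ * (M.T (M.Q x) * M.T M.δ) := by
          rw [← M.sm5]; simp only [mul_assoc]
      _ = y * M.μ * M.Q x * M.δ * (M.T (M.Q x) * M.T M.δ) := by
          rw [← M.sm7]; simp only [mul_assoc]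
      _ = y * (M.T y * M.Q x) * M.δ * (M.T (M.Q x) * M.T M.δ) := by
          rw [hy.1]; simp only [mul_assoc]
      _ = y * M.Q x * (M.T y * M.δ) * (M.T (M.Q x) * M.T M.δ) := by
          rw [M.sm6]; simp only [mul_assoc]
      _ = y * M.Q x * M.δ * M.T (y * M.Q x * M.δ) := by
          rw [← M.sm8]; simp only [map_mul, mul_assoc]
  · calc y * M.Q x * M.δ * M.η = y * (M.Q x * M.Q M.η) * M.η := by
          rw [mul_assoc _ M.δ, M.sm17]; simp only [mul_assoc]
      _ = 1 := by rw [← map_mul, hx.2, map_one, mul_one, hy.2]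

theorem hot_assoc (x y z : A) : M.hot (M.hot x y) z = M.hot x (M.hot y z) :=
  calc z * M.Q (y * M.Q x * M.δ) * M.δ
      = z * M.Q y * M.Q (M.Q x) * (M.Q M.δ * M.δ) := by simp only [map_mul, mul_assoc]
    _ = z * M.Q y * (M.Q (M.Q x) * M.δ) * M.δ := by rw [M.sm12]; simp only [mul_assoc]
    _ = z * M.Q y * M.δ * M.Q x * M.δ := by rw [← M.sm3]; simp only [mul_assoc]

theorem ε_hot (x : A) : M.hot M.ε x = x := by
  rw [SMM.hot, mul_assoc, M.sm14, mul_one]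

theorem hot_ε (x : A) : M.hot x M.ε = x := by
  rw [SMM.hot, ← M.sm4, mul_assoc, M.sm13, mul_one]

theorem isTAlg_ε : M.IsTAlg M.ε := ⟨M.sm16, M.sm18⟩

end SMM

/-- The horizontal tensor product `x ⊛ y := y Q(x) δ` of
`T`-algebras is a `T`-algebra, is strictly associative, and `ε` is a
`T`-algebra which is a two-sided unit for `⊛`. -/
theorem hot_strict_monoidal_on_T_algebras {A : Type*} [Monoid A] (M : SMM A) :
    (∀ x y : A, M.IsTAlg x → M.IsTAlg y → M.IsTAlg (M.hot x y)) ∧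
    (∀ x y z : A, M.IsTAlg x → M.IsTAlg y → M.IsTAlg z →
      M.hot (M.hot x y) z = M.hot x (M.hot y z)) ∧
    M.IsTAlg M.ε ∧
    (∀ x : A, M.IsTAlg x → M.hot M.ε x = x ∧ M.hot x M.ε = x) := by
  exact ⟨fun _ _ hx hy => hx.hot hy, fun x y z _ _ _ => M.hot_assoc x y z, M.isTAlg_ε,
    fun x _ => ⟨M.ε_hot x, M.hot_ε x⟩⟩
end

section
/- Let (A, T, Q, μ, η, δ, ε) be a skew monoidal monoid and let x₁, x₂, y₁, y₂ be T-algebras. If s is an arrow of T-algebras x₁ → y₁ (i.e., sx₁ = y₁T(s)) and t is an arrow x₂ → y₂ (i.e., tx₂ = y₂T(t)), then the element s ⊛ t := y₂Q(s)ηt is an arrow of T-algebras from x₁ ⊛ x₂ to y₁ ⊛ y₂, i.e., (y₂Q(s)ηt)(x₂Q(x₁)δ) = (y₂Q(y₁)δ)T(y₂Q(s)ηt). -/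
/-- The horizontal tensor product of arrows of `T`-algebras,
`s ⊛ t := y₂ Q(s) η t`, is an arrow `x₁ ⊛ x₂ → y₁ ⊛ y₂`. -/
theorem hot_of_arrows {A : Type*} [Monoid A] (M : SMM A)
    (x₁ x₂ y₁ y₂ : A)
    (hx₁ : M.IsTAlg x₁) (hx₂ : M.IsTAlg x₂)
    (hy₁ : M.IsTAlg y₁) (hy₂ : M.IsTAlg y₂)
    (s t : A)
    (hs : s * x₁ = y₁ * M.T s) (ht : t * x₂ = y₂ * M.T t) :
    (y₂ * M.Q s * M.η * t) * (x₂ * M.Q x₁ * M.δ) =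
      (y₂ * M.Q y₁ * M.δ) * M.T (y₂ * M.Q s * M.η * t) := by
  have absorb : ∀ a : A, y₂ * M.Q a * M.T y₂ = y₂ * M.Q a * M.μ := fun a => by
    rw [mul_assoc, ← M.sm6, ← mul_assoc, ← hy₂.1, mul_assoc, M.sm7, ← mul_assoc]
  have hμη : ∀ a b : A, a * M.μ * M.η * b = a * b := fun a b => by
    rw [mul_assoc a, M.sm10, mul_one]
  calc (y₂ * M.Q s * M.η * t) * (x₂ * M.Q x₁ * M.δ)
      = y₂ * M.Q s * M.η * (t * x₂) * M.Q x₁ * M.δ := by simp only [mul_assoc]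
    _ = y₂ * M.Q s * (M.η * y₂) * (M.T t * M.Q x₁) * M.δ := by
        rw [ht]; simp only [mul_assoc]
    _ = (y₂ * M.Q s * M.T y₂) * M.η * (M.Q x₁ * M.T t) * M.δ := by
        rw [M.sm2, M.sm6]; simp only [mul_assoc]
    _ = y₂ * M.Q s * (M.Q x₁ * M.T t) * M.δ := by rw [absorb, hμη]
    _ = y₂ * M.Q (s * x₁) * (M.T t * M.δ) := by
        rw [map_mul]; simp only [mul_assoc]
    _ = y₂ * M.Q y₁ * M.Q (M.T s) * (M.μ * M.T M.η) * M.δ * M.T t := by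
        rw [hs, map_mul, ← M.sm8, M.sm11, mul_one]; simp only [mul_assoc]
    _ = y₂ * M.Q y₁ * M.Q (M.T s) * M.μ * (M.T M.η * M.δ) * M.T t := by
        simp only [mul_assoc]
    _ = y₂ * M.Q y₁ * (M.Q (M.T s) * (M.μ * M.δ)) * M.T M.η * M.T t := by
        rw [← M.sm8]; simp only [mul_assoc]
    _ = (y₂ * M.Q y₁ * M.μ) * M.δ * M.T (M.Q s) * M.T M.η * M.T t := by
        rw [← M.sm5]; simp only [mul_assoc]
    _ = y₂ * M.Q y₁ * (M.T y₂ * M.δ) * M.T (M.Q s) * M.T M.η * M.T t := by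
        rw [← absorb]; simp only [mul_assoc]
    _ = (y₂ * M.Q y₁ * M.δ) * M.T (y₂ * M.Q s * M.η * t) := by
        rw [← M.sm8]; simp only [map_mul, mul_assoc]
end

section
/- Let (A, T, Q, μ, η, δ, ε) be a skew monoidal monoid. Then μ is a T-algebra, and for every T-algebra x one has the equality of sets {s ∈ A : sμ = xT(s)} = {xT(a) : a ∈ A}; that is, an element s ∈ A is an arrow of T-algebras μ → x if and only if s = xT(a) for some a ∈ A. Moreover, if s and t are arrows of T-algebras x → y with sx = tx, then s = t. -/
/-- `μ` is a `T`-algebra, the arrows `μ → x` are exactly the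
elements `x T(a)`, `a ∈ A`, and precomposition with `x : μ → x` is injective
on arrows (faithfulness). -/
theorem arrows_from_mu {A : Type*} [Monoid A] (M : SMM A) :
    M.IsTAlg M.μ ∧
    (∀ x : A, M.IsTAlg x →
      {s : A | s * M.μ = x * M.T s} = {s : A | ∃ a : A, s = x * M.T a}) ∧
    (∀ x y s t : A, M.IsTAlg x → M.IsTAlg y →
      s * x = y * M.T s → t * x = y * M.T t → s * x = t * x → s = t) := by
  refine ⟨⟨M.sm9.symm, M.sm10⟩, ?_, ?_⟩
  · rintro x ⟨hx, -⟩
    ext s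
    simp only [Set.mem_ofPred_eq]
    constructor
    · intro hs
      refine ⟨s * M.η, ?_⟩
      rw [map_mul, ← mul_assoc, ← hs, mul_assoc, M.sm11, mul_one]
    · rintro ⟨a, rfl⟩
      rw [mul_assoc, ← M.sm1, ← mul_assoc, hx, mul_assoc, map_mul]
  · rintro x y s t ⟨-, hx⟩ - - - h
    calc s = s * x * M.η := by rw [mul_assoc, hx, mul_one]
      _ = t * x * M.η := by rw [h]
      _ = t := by rw [mul_assoc, hx, mul_one]
end

section
/- Let (A, T, Q, μ, η, δ, ε) be a skew monoidal monoid, let x and y be T-algebras, and let f : {xT(a) : a ∈ A} → {yT(a) : a ∈ A} be a function satisfying f(sg) = f(s)g for all s ∈ xT(A) and all g ∈ G := {μT(a) : a ∈ A}. Then there exists a unique t ∈ A with tx = yT(t) (an arrow of T-algebras x → y) such that f(s) = ts for all s ∈ xT(A). -/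
namespace SMM

variable {A : Type*} [Monoid A]

theorem IsTAlg.mul_T_mul_η {M : SMM A} {x : A} (hx : M.IsTAlg x) (a : A) :
    x * M.T a * M.η = a := by
  rw [mul_assoc, ← M.sm2, ← mul_assoc, hx.2, one_mul]

theorem IsTAlg.mul_T_mul_μ_mul_T {M : SMM A} {x : A} (hx : M.IsTAlg x) (a b : A) :
    x * M.T a * (M.μ * M.T b) = x * M.T (x * M.T a * b) := by
  calc x * M.T a * (M.μ * M.T b) = x * (M.T a * M.μ) * M.T b := by simp only [mul_assoc]
    _ = x * M.μ * (M.T (M.T a) * M.T b) := by rw [← M.sm1]; simp only [mul_assoc]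
    _ = x * M.T (x * M.T a * b) := by rw [hx.1]; simp only [map_mul, mul_assoc]

end SMM

/-- Fullness. Every right `G`-equivariant map
`f : xT(A) → yT(A)` between the hom-sets `xT(A) = Aᵀ(μ,x)` is given by left
multiplication with a unique arrow of `T`-algebras `t : x → y`. -/
theorem G_module_maps_are_full {A : Type*} [Monoid A] (M : SMM A)
    (x y : A) (hx : M.IsTAlg x) (hy : M.IsTAlg y)
    (f : {s : A // ∃ a : A, s = x * M.T a} → {s : A // ∃ a : A, s = y * M.T a})
    (hf : ∀ (s : {s : A // ∃ a : A, s = x * M.T a}) (g : A),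
      (∃ a : A, g = M.μ * M.T a) →
      ∀ (hmem : ∃ a : A, s.1 * g = x * M.T a),
        (f ⟨s.1 * g, hmem⟩).1 = (f s).1 * g) :
    ∃! t : A, t * x = y * M.T t ∧
      ∀ s : {s : A // ∃ a : A, s = x * M.T a}, (f s).1 = t * s.1 := by
  obtain ⟨t, ht⟩ := (f ⟨x, 1, by simp⟩).2
  have hfx (b : A) : (f ⟨x * M.T (x * b), _, rfl⟩).1 = y * M.T (y * M.T t * b) := by
    have hxg : x * (M.μ * M.T b) = x * M.T (x * b) := by
      simpa using hx.mul_T_mul_μ_mul_T 1 b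
    have h := hf ⟨x, 1, by simp⟩ (M.μ * M.T b) ⟨b, rfl⟩ ⟨_, hxg⟩
    rw [ht, hy.mul_T_mul_μ_mul_T] at h
    simpa only [hxg] using h
  have hf_apply (a : A) : (f ⟨x * M.T a, _, rfl⟩).1 = y * M.T (t * a) := by
    have h := hfx (M.η * a)
    simpa only [← mul_assoc, hx.2, one_mul, hy.mul_T_mul_η] using h
  have htx : t * x = y * M.T t := by
    have h := (hf_apply (x * 1)).symm.trans (hfx 1)
    simpa only [mul_one, hy.mul_T_mul_η] using congrArg (· * M.η) h
  refine ⟨t, ⟨htx, ?_⟩, ?_⟩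
  · rintro ⟨_, a, rfl⟩
    rw [hf_apply, map_mul, ← mul_assoc, ← htx, mul_assoc]
  · rintro u ⟨-, hu⟩
    have h : y * M.T t = u * x := ht.symm.trans (hu ⟨x, 1, by simp⟩)
    rw [← hy.mul_T_mul_η t, h, mul_assoc, hx.2, mul_one]
end

section
/- Let (A, T, Q, μ, η, δ, ε) be a skew monoidal monoid and let G := {μT(a) : a ∈ A}, a submonoid of A. Let M be a set with a right G-action (m·(gh) = (m·g)·h and m·1 = m) and suppose m₀ ∈ M is such that the map A → M, a ↦ m₀·T(a), is a bijection (note T(a) ∈ G). Then the unique element x ∈ A satisfying m₀·μ = m₀·T(x) is a T-algebra, i.e., xμ = xT(x) and xη = 1. -/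
/-- Every source-regular right `G`-module comes from a
`T`-algebra: if `a ↦ m₀ · T(a)` is a bijection and `m₀ · μ = m₀ · T(x)`,
then `x` is a `T`-algebra. -/
theorem source_regular_module_gives_T_algebra {A : Type*} [Monoid A]
    (Mo : SMM A) {M : Type*} (act : M → A → M)
    (hact_mul : ∀ m : M, ∀ g ∈ {g : A | ∃ a : A, g = Mo.μ * Mo.T a},
      ∀ h ∈ {g : A | ∃ a : A, g = Mo.μ * Mo.T a},
        act m (g * h) = act (act m g) h)
    (hact_one : ∀ m : M, act m 1 = m)
    (m₀ : M)
    (hbij : Function.Bijective (fun a : A => act m₀ (Mo.T a)))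
    (x : A) (hx : act m₀ Mo.μ = act m₀ (Mo.T x)) :
    x * Mo.μ = x * Mo.T x ∧ x * Mo.η = 1 := by
  have mem_T (a : A) : Mo.T a ∈ {g : A | ∃ a : A, g = Mo.μ * Mo.T a} :=
    ⟨Mo.η * a, by rw [map_mul, ← mul_assoc, Mo.sm11, one_mul]⟩
  have mem_μ : Mo.μ ∈ {g : A | ∃ a : A, g = Mo.μ * Mo.T a} :=
    ⟨1, by rw [map_one, mul_one]⟩
  have act_T_mul (a : A) : act m₀ (Mo.T (x * a)) = act m₀ (Mo.μ * Mo.T a) := by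
    rw [map_mul, hact_mul _ _ (mem_T x) _ (mem_T a), ← hx, hact_mul _ _ mem_μ _ (mem_T a)]
  constructor <;> apply hbij.injective <;> dsimp only
  · rw [act_T_mul, act_T_mul, Mo.sm9, Mo.sm1, hact_mul _ _ mem_μ _ mem_μ, hx,
      hact_mul _ _ (mem_T x) _ mem_μ]
  · rw [act_T_mul, Mo.sm11, map_one]
end

section
/- Let (A, T, Q, μ, η, δ, ε) be a skew monoidal monoid. If u and v are Q-coalgebras, then u ⊛' v := μT(v)u is again a Q-coalgebra. The vertical tensor product is strictly associative on Q-coalgebras, (u ⊛' v) ⊛' w = u ⊛' (v ⊛' w), the element η is a Q-coalgebra, and η ⊛' v = v and u ⊛' η = u for all Q-coalgebras u, v. -/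
namespace SMM

variable {A : Type*} [Monoid A] (M : SMM A)

theorem counit_mul_vot {u v : A} (hu : M.ε * u = 1) (hv : M.ε * v = 1) :
    M.ε * M.vot u v = 1 := by
  calc M.ε * (M.μ * M.T v * u) = (M.ε * M.μ) * M.T v * u := by simp only [mul_assoc]
    _ = M.ε * M.T (M.ε * v) * u := by rw [M.sm16, map_mul]; simp only [mul_assoc]
    _ = 1 := by rw [hv, map_one, mul_one, hu]

theorem isQCoalg_vot {u v : A} (hu : M.IsQCoalg u) (hv : M.IsQCoalg v) :
    M.IsQCoalg (M.vot u v) := by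
  refine ⟨Eq.symm ?_, M.counit_mul_vot hu.2 hv.2⟩
  calc M.δ * (M.μ * M.T v * u) = (M.δ * M.μ) * M.T v * u := by simp only [mul_assoc]
    _ = M.Q M.μ * M.μ * M.δ * M.T (M.δ * v) * u := by
      rw [← M.sm15, map_mul]; simp only [mul_assoc]
    _ = M.Q M.μ * (M.μ * M.δ * M.T (M.Q v)) * M.T v * u := by
      rw [← hv.1, map_mul]; simp only [mul_assoc]
    _ = M.Q M.μ * M.Q (M.T v) * M.μ * (M.δ * M.T v) * u := by
      rw [M.sm5]; simp only [mul_assoc]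
    _ = M.Q M.μ * M.Q (M.T v) * M.μ * M.T v * (M.δ * u) := by
      rw [M.sm8]; simp only [mul_assoc]
    _ = M.Q M.μ * M.Q (M.T v) * M.μ * (M.T v * M.Q u) * u := by
      rw [← hu.1]; simp only [mul_assoc]
    _ = M.Q M.μ * M.Q (M.T v) * (M.μ * M.Q u) * M.T v * u := by
      rw [M.sm6]; simp only [mul_assoc]
    _ = M.Q (M.μ * M.T v * u) * (M.μ * M.T v * u) := by
      rw [M.sm7]; simp only [map_mul, mul_assoc]

theorem vot_assoc (u v w : A) : M.vot (M.vot u v) w = M.vot u (M.vot v w) := by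
  symm
  calc M.μ * M.T (M.μ * M.T w * v) * u
      = (M.μ * M.T M.μ) * M.T (M.T w) * M.T v * u := by simp only [map_mul, mul_assoc]
    _ = M.μ * (M.μ * M.T (M.T w)) * M.T v * u := by rw [M.sm9]; simp only [mul_assoc]
    _ = M.μ * M.T w * (M.μ * M.T v * u) := by rw [M.sm1]; simp only [mul_assoc]

theorem isQCoalg_unit : M.IsQCoalg M.η :=
  ⟨M.sm17.symm, M.sm18⟩

theorem unit_vot (u : A) : M.vot M.η u = u := by
  rw [vot, mul_assoc, ← M.sm2, ← mul_assoc, M.sm10, one_mul]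

theorem vot_unit (u : A) : M.vot u M.η = u := by
  rw [vot, M.sm11, one_mul]

end SMM

/-- The vertical tensor product `u ⊛' v := μ T(v) u` of
`Q`-coalgebras is a `Q`-coalgebra, is strictly associative, and `η` is a
`Q`-coalgebra which is a two-sided unit for `⊛'`. -/
theorem vot_strict_monoidal_on_Q_coalgebras {A : Type*} [Monoid A] (M : SMM A) :
    (∀ u v : A, M.IsQCoalg u → M.IsQCoalg v → M.IsQCoalg (M.vot u v)) ∧
    (∀ u v w : A, M.IsQCoalg u → M.IsQCoalg v → M.IsQCoalg w →
      M.vot (M.vot u v) w = M.vot u (M.vot v w)) ∧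
    M.IsQCoalg M.η ∧
    (∀ u : A, M.IsQCoalg u → M.vot M.η u = u ∧ M.vot u M.η = u) :=
  ⟨fun _ _ => M.isQCoalg_vot, fun u v w _ _ _ => M.vot_assoc u v w, M.isQCoalg_unit,
    fun u _ => ⟨M.unit_vot u, M.vot_unit u⟩⟩
end

section
/- Let (A, T, Q, μ, η, δ, ε) be a skew monoidal monoid and G := {μT(a) : a ∈ A}. Then the map K : A → G, K(a) := μT(a), is a bijection with inverse g ↦ gη; that is, μT(a)η = a for all a ∈ A and μT(gη) = g for all g ∈ G. Moreover K is an anti-morphism with respect to the vertical tensor product: K(u ⊛' v) = K(v)K(u), i.e., μT(μT(v)u) = μT(v)μT(u) for all u, v ∈ A. -/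
/-- `K(a) := μ T(a)` is a bijection `A → G` with inverse
`g ↦ g η`, and `K` is an anti-morphism for the vertical tensor product:
`K(u ⊛' v) = K(v) K(u)`. -/
theorem K_bijection_antimorphism {A : Type*} [Monoid A] (M : SMM A) :
    (∀ a : A, M.μ * M.T a * M.η = a) ∧
    (∀ g ∈ {g : A | ∃ a : A, g = M.μ * M.T a}, M.μ * M.T (g * M.η) = g) ∧
    (∀ u v : A, M.μ * M.T (M.vot u v) = (M.μ * M.T v) * (M.μ * M.T u)) := by
  have key : ∀ a : A, M.μ * M.T a * M.η = a := fun a => by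
    rw [mul_assoc, ← M.sm2, ← mul_assoc, M.sm10, one_mul]
  refine ⟨key, ?_, fun u v => ?_⟩
  · rintro g ⟨a, rfl⟩
    rw [key]
  · calc M.μ * M.T (M.vot u v)
        = M.μ * M.T M.μ * M.T (M.T v) * M.T u := by
          simp only [SMM.vot, map_mul, mul_assoc]
      _ = M.μ * (M.μ * M.T (M.T v)) * M.T u := by
          rw [M.sm9, mul_assoc M.μ M.μ]
      _ = (M.μ * M.T v) * (M.μ * M.T u) := by
          rw [M.sm1]
          simp only [mul_assoc]
end

section
/- Let (A, T, Q, μ, η, δ, ε) be a skew monoidal monoid. Then for every f ∈ F := {Q(a)δ : a ∈ A} and g ∈ G := {μT(a) : a ∈ A} the following commutation (smash product) relation holds in A: fg = μT(δgη) · Q(εfμ) · δ. Equivalently, for all a, b ∈ A: (Q(a)δ)(μT(b)) = μT(δμT(b)η) Q(ε Q(a)δ μ) δ. -/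
namespace SMM

variable {A : Type*} [Monoid A] (M : SMM A)

theorem mu_mul_T_mul_eta_s17 (b : A) : M.μ * M.T b * M.η = b := by
  rw [mul_assoc, ← M.sm2, ← mul_assoc, M.sm10, one_mul]

theorem eps_mul_Q_mul_delta (a : A) : M.ε * (M.Q a * M.δ) = a := by
  rw [← mul_assoc, ← M.sm4, mul_assoc, M.sm13, mul_one]

theorem Q_mul_delta_mul_mu_mul_T (a b : A) :
    M.Q a * M.δ * (M.μ * M.T b) = M.μ * M.T (M.δ * b) * M.Q (a * M.μ) * M.δ :=
  calc
    M.Q a * M.δ * (M.μ * M.T b) = M.Q a * (M.δ * M.μ) * M.T b := by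
      simp only [mul_assoc]
    _ = M.Q (a * M.μ) * M.μ * (M.δ * M.T (M.δ * b)) := by
      rw [← M.sm15]
      simp only [map_mul, mul_assoc]
    _ = M.μ * M.T (M.δ * b) * M.Q (a * M.μ) * M.δ := by
      rw [M.sm8, ← M.sm7, mul_assoc M.μ (M.T _), M.sm6]
      simp only [mul_assoc]

end SMM

/-- the smash-product commutation relation
`f g = μ T(δ g η) Q(ε f μ) δ` for `f ∈ F = Q(A)δ` and `g ∈ G = μT(A)`. -/
theorem smash_commutation_relation {A : Type*} [Monoid A] (M : SMM A) :
    (∀ f ∈ {f : A | ∃ a : A, f = M.Q a * M.δ},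
     ∀ g ∈ {g : A | ∃ b : A, g = M.μ * M.T b},
      f * g = M.μ * M.T (M.δ * g * M.η) * M.Q (M.ε * f * M.μ) * M.δ) ∧
    (∀ a b : A,
      (M.Q a * M.δ) * (M.μ * M.T b) =
        M.μ * M.T (M.δ * (M.μ * M.T b) * M.η) *
          M.Q (M.ε * (M.Q a * M.δ) * M.μ) * M.δ) := by
  have h : ∀ a b : A,
      (M.Q a * M.δ) * (M.μ * M.T b) =
        M.μ * M.T (M.δ * (M.μ * M.T b) * M.η) *
          M.Q (M.ε * (M.Q a * M.δ) * M.μ) * M.δ := fun a b => by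
    rw [mul_assoc M.δ, M.mu_mul_T_mul_eta_s17, M.eps_mul_Q_mul_delta,
      M.Q_mul_delta_mul_mu_mul_T]
  refine ⟨?_, h⟩
  rintro _ ⟨a, rfl⟩ _ ⟨b, rfl⟩
  exact h a b
end

section
/- Let (A, T, Q, μ, η, δ, ε) be a skew monoidal monoid. If the monoid A is commutative, then the skew monoidal monoid is trivial: T and Q are the identity map of A, μ = ε, δ = η, and εη = ηε = 1 (so ε is invertible with inverse η). -/
/-- If the underlying monoid of a skew monoidal monoid is
commutative then the skew monoidal monoid is trivial. -/
theorem commutative_implies_trivial {A : Type*} [Monoid A] (M : SMM A)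
    (hcomm : ∀ a b : A, a * b = b * a) :
    (∀ a : A, M.T a = a) ∧
    (∀ a : A, M.Q a = a) ∧
    M.μ = M.ε ∧
    M.δ = M.η ∧
    M.ε * M.η = 1 ∧
    M.η * M.ε = 1 := by
  have hηε : M.η * M.ε = 1 := by rw [hcomm, M.sm18]
  have hδε : M.δ * M.ε = 1 := by rw [hcomm, M.sm13]
  have hημ : M.η * M.μ = 1 := by rw [hcomm, M.sm10]
  refine ⟨fun a => ?_, fun a => ?_, ?_, ?_, M.sm18, hηε⟩
  · calc M.T a = M.T a * M.η * M.μ := by rw [mul_assoc, hημ, mul_one]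
      _ = M.μ * (M.η * a) := by rw [← M.sm2, hcomm]
      _ = a := by rw [← mul_assoc, M.sm10, one_mul]
  · calc M.Q a = M.δ * (M.ε * M.Q a) := by rw [← mul_assoc, hδε, one_mul]
      _ = a * M.ε * M.δ := by rw [← M.sm4, hcomm]
      _ = a := by rw [mul_assoc, M.sm13, mul_one]
  · exact left_inv_eq_right_inv M.sm10 hηε
  · exact left_inv_eq_right_inv hδε M.sm18
end

section
/- Let (A, T, Q, μ, η, δ, ε) be a skew monoidal monoid. If η is invertible in A (there exists η' ∈ A with ηη' = η'η = 1), then the skew monoidal monoid is trivial: A is commutative, T and Q are the identity map of A, μ = ε, δ = η, and εη = ηε = 1 (so ε is invertible with inverse η). -/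
/-- If `η` is invertible then the skew monoidal monoid is
trivial. -/
theorem eta_invertible_implies_trivial {A : Type*} [Monoid A] (M : SMM A)
    (η' : A) (hη₁ : M.η * η' = 1) (hη₂ : η' * M.η = 1) :
    (∀ a b : A, a * b = b * a) ∧
    (∀ a : A, M.T a = a) ∧
    (∀ a : A, M.Q a = a) ∧
    M.μ = M.ε ∧
    M.δ = M.η ∧
    M.ε * M.η = 1 ∧
    M.η * M.ε = 1 := by
  have hμ : M.μ = η' := left_inv_eq_right_inv M.sm10 hη₁
  have hε : M.ε = η' := left_inv_eq_right_inv M.sm18 hη₁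
  have hδ : M.δ = M.η :=
    (left_inv_eq_right_inv hη₁ (hε ▸ M.sm13)).symm
  have hT (a : A) : M.T a = M.η * a * η' := by
    rw [M.sm2, mul_assoc, hη₁, mul_one]
  have hT_surj (a : A) : M.T (η' * a * M.η) = a := by
    rw [hT, mul_assoc η', ← mul_assoc M.η η', hη₁, one_mul, mul_assoc, hη₁, mul_one]
  have hQ_central (a b : A) : a * M.Q b = M.Q b * a := by
    simpa only [hT_surj] using M.sm6 (η' * a * M.η) b
  have hQ (a : A) : M.Q a = a := by
    have h : a * M.ε = M.Q a * M.ε := (M.sm4 a).trans (hQ_central M.ε a)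
    simpa only [mul_assoc, M.sm18, mul_one] using congrArg (· * M.η) h.symm
  have hcomm (a b : A) : a * b = b * a := by
    simpa only [hQ] using hQ_central a b
  refine ⟨hcomm, fun a => ?_, hQ, hμ.trans hε.symm, hδ, M.sm18, hε ▸ hη₁⟩
  rw [hT, hcomm M.η a, mul_assoc, hη₁, mul_one]
end
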